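/- For all n ∈ ℕ with n ≥ 3, the cycle graph C_n on n vertices satisfies gc(C_n) ≥ n − 2. -/

import Mathlib

open Matrix

def GCFeasible {V : Type*} [Fintype V] (A : Matrix V V ℝ) (m : ℕ) : Prop :=
  ∃ (k : ℕ) (P : Matrix (Fin k) V ℝ) (w : Fin k → ℝ),
    (∀ p i, P p i = 1 ∨ P p i = -1) ∧
    (∀ i, A i i = 0) ∧
    (∀ i j, i ≠ j → A i j = (Pᵀ * Matrix.diagonal w * P) i j) ∧
    m = (Finset.univ.filter fun p => w p ≠ 0).card

noncomputable def gc {V : Type*} [Fintype V] (A : Matrix V V ℝ) : ℕ :=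
  sInf { m | GCFeasible A m }

open scoped Classical in
noncomputable def gcGraph {V : Type*} [Fintype V] (G : SimpleGraph V) : ℕ :=
  gc (Matrix.of fun u v => if G.Adj u v then (1 : ℝ) else 0)

/-- The cycle graph C_n on n vertices, with edges {i, i+1 mod n}. -/
def cycleGraphFin (n : ℕ) : SimpleGraph (Fin n) :=
  SimpleGraph.fromRel fun u v => (u.val + 1) % n = v.val

/-- The index type of the rows of a sign matrix can be any finite type. -/
theorem GCFeasible.of_fintype {V ι : Type*} [Fintype V] [Fintype ι] {A : Matrix V V ℝ}
    (P : Matrix ι V ℝ) (w : ι → ℝ) (hP : ∀ p i, P p i = 1 ∨ P p i = -1)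
    (hA : ∀ i, A i i = 0) (h : ∀ i j, i ≠ j → A i j = ∑ p, w p * (P p i * P p j)) :
    ∃ m, GCFeasible A m := by
  let e := Fintype.equivFin ι
  refine ⟨_, Fintype.card ι, P.submatrix e.symm id, fun p => w (e.symm p),
    fun p i => hP _ i, hA, fun i j hij => ?_, rfl⟩
  rw [h i j hij, Matrix.mul_apply, ← e.symm.sum_comp]
  refine Finset.sum_congr rfl fun p _ => ?_
  rw [Matrix.mul_diagonal, Matrix.transpose_apply, Matrix.submatrix_apply,
    Matrix.submatrix_apply, id, id]
  ring

/-- The vector of ones with the entry at `u` flipped to `-1`. -/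
def flipAt {V : Type*} [DecidableEq V] (u i : V) : ℝ := if u = i then -1 else 1

theorem flipAt_eq_or {V : Type*} [DecidableEq V] (u i : V) :
    flipAt u i = 1 ∨ flipAt u i = -1 := by
  unfold flipAt; split_ifs <;> simp

theorem one_sub_flipAt_mul_flipAt {V : Type*} [DecidableEq V] (u : V) {i j : V} (hij : i ≠ j) :
    1 - flipAt u i * flipAt u j =
      2 * ((if u = i then 1 else 0) + (if u = j then 1 else 0)) := by
  unfold flipAt
  by_cases hi : u = i
  · subst hi
    norm_num [hij]
  · by_cases hj : u = j
    · subst hj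
      norm_num [hi]
    · norm_num [hi, hj]

/-- Every symmetric matrix with zero diagonal has a graph coupling. -/
theorem exists_gcFeasible {V : Type*} [Fintype V] {A : Matrix V V ℝ} (hsymm : A.IsSymm)
    (hdiag : ∀ i, A i i = 0) : ∃ m, GCFeasible A m := by
  classical
  refine GCFeasible.of_fintype (ι := V × V × Bool × Bool)
    (Matrix.of fun p i => (if p.2.2.1 then flipAt p.1 i else 1) * (if p.2.2.2 then flipAt p.2.1 i else 1))
    (fun p => A p.1 p.2.1 / 8 * ((if p.2.2.1 then -1 else 1) * (if p.2.2.2 then -1 else 1)))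
    ?_ hdiag fun i j hij => ?_
  · rintro ⟨u, v, x, y⟩ i
    rcases flipAt_eq_or u i with hu | hu <;> rcases flipAt_eq_or v i with hv | hv <;>
      cases x <;> cases y <;> simp [hu, hv]
  · have key : ∀ u v : V, (∑ q : Bool × Bool,
        A u v / 8 * ((if q.1 then -1 else 1) * (if q.2 then -1 else 1)) *
          (((if q.1 then flipAt u i else 1) * (if q.2 then flipAt v i else 1)) *
           ((if q.1 then flipAt u j else 1) * (if q.2 then flipAt v j else 1)))) =
        1 / 2 * (A u v * ((if u = i then 1 else 0) + (if u = j then 1 else 0)) *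
          ((if v = i then 1 else 0) + (if v = j then 1 else 0))) := by
      intro u v
      have hu := one_sub_flipAt_mul_flipAt u hij
      have hv := one_sub_flipAt_mul_flipAt v hij
      calc _ = A u v / 8 * (1 - flipAt u i * flipAt u j) * (1 - flipAt v i * flipAt v j) := by
            simp only [Fintype.sum_prod_type, Fintype.sum_bool, if_true, Bool.false_eq_true,
              if_false]
            ring
        _ = _ := by rw [hu, hv]; ring
    rw [Fintype.sum_prod_type]
    trans ∑ u : V, ∑ v : V,
        1 / 2 * (A u v * ((if u = i then 1 else 0) + (if u = j then 1 else 0)) *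
          ((if v = i then 1 else 0) + (if v = j then 1 else 0)))
    swap
    · refine Finset.sum_congr rfl fun u _ => ?_
      rw [Fintype.sum_prod_type]
      exact Finset.sum_congr rfl fun v _ => (key u v).symm
    simp only [mul_add, Finset.sum_add_distrib, mul_ite, mul_one,
      mul_zero, Finset.sum_ite_eq', Finset.mem_univ, if_true,
      hdiag, hsymm.apply i j]
    ring

/-- A coupling matrix has rank at most the number of its nonzero weights. -/
theorem rank_transpose_mul_diagonal_mul_le {V ι : Type*} [Fintype V] [Fintype ι] [DecidableEq ι]
    (P : Matrix ι V ℝ) (w : ι → ℝ) :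
    (Pᵀ * Matrix.diagonal w * P).rank ≤ (Finset.univ.filter fun p => w p ≠ 0).card :=
  calc (Pᵀ * Matrix.diagonal w * P).rank ≤ (Pᵀ * Matrix.diagonal w).rank := rank_mul_le_left _ _
    _ ≤ (Matrix.diagonal w).rank := rank_mul_le_right _ _
    _ = _ := by rw [Matrix.rank_diagonal, Fintype.card_subtype]

/-- Square submatrices with unit lower triangular shape bound the rank from below. -/
theorem le_rank_of_submatrix_lowerTriangular {m : ℕ} {V : Type*} [Fintype V] (B : Matrix V V ℝ)
    (r c : Fin m → V) (hdiag : ∀ i, B (r i) (c i) = 1)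
    (hupper : ∀ i j, i < j → B (r i) (c j) = 0) : m ≤ B.rank := by
  have hdet : (B.submatrix r c).det = 1 := by
    rw [Matrix.det_of_isLowerTriangular (B.submatrix r c) fun i j hij => hupper i j hij]
    exact Finset.prod_eq_one fun i _ => hdiag i
  have hrank := Matrix.rank_of_isUnit (B.submatrix r c)
    ((Matrix.isUnit_iff_isUnit_det _).2 (by rw [hdet]; exact isUnit_one))
  rw [Fintype.card_fin] at hrank
  exact hrank.symm.le.trans (Matrix.rank_submatrix_le B r c)

theorem cycleGraphFin_adj {n : ℕ} (u v : Fin n) : (cycleGraphFin n).Adj u v ↔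
    u ≠ v ∧ ((u.val + 1) % n = v.val ∨ (v.val + 1) % n = u.val) := by
  simp [cycleGraphFin]

/-- Corollary: for n ≥ 3, gc(C_n) ≥ n − 2. -/
theorem cycle_lower {n : ℕ} (h : 3 ≤ n) : n - 2 ≤ gcGraph (cycleGraphFin n) := by
  unfold gcGraph gc
  classical
  refine le_csInf ?_ ?_
  · refine exists_gcFeasible ?_ fun i => by simp
    ext u v
    simp [SimpleGraph.adj_comm]
  · rintro m ⟨k, P, w, -, -, hA, rfl⟩
    refine le_trans ?_ (rank_transpose_mul_diagonal_mul_le P w)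
    refine le_rank_of_submatrix_lowerTriangular _ (fun i => ⟨i, by omega⟩)
      (fun i => ⟨i + 1, by omega⟩) (fun i => ?_) fun i j hij => ?_
    · rw [← hA _ _ (by simp), Matrix.of_apply, if_pos]
      rw [cycleGraphFin_adj]
      exact ⟨by simp, Or.inl (Nat.mod_eq_of_lt (by simp; omega))⟩
    · have hlt : i.val < j.val := hij
      rw [← hA _ _ (by simp; omega), Matrix.of_apply, if_neg]
      rw [cycleGraphFin_adj]
      simp only [not_and, not_or]
      refine fun _ => ⟨?_, ?_⟩ <;> rw [Nat.mod_eq_of_lt (by omega)] <;> omega
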